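/- Let 1 < p ≤ 2 and 2 ≤ r ≤ ∞ satisfy 1/p = 1/r + 1/2, let (λ_n)_{n∈ℤ} ∈ ℓ_r(ℤ) with |λ_n| ≤ 1 for all n, and let T_λ : C([0,1], ℓ₂(ℤ)) → ℓ₂(ℤ) be the bounded operator T_λφ = (λ_n ⟨φ̂(n), e_n⟩)_{n∈ℤ}, where φ̂(n) = ∫₀¹ φ(t) e^{2πint} dt (Bochner integral). Then the induced operator T_λ# maps C[0,1] into Π_p(ℓ₂(ℤ), ℓ₂(ℤ)), and T_λ# : C[0,1] → Π_p(ℓ₂(ℤ), ℓ₂(ℤ)) is p-summing. -/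

import Mathlib

set_option maxHeartbeats 1000000
set_option synthInstance.maxHeartbeats 400000

noncomputable section

open scoped BigOperators NNReal ENNReal
open NormedSpace

/-- The scalar field. -/
notation "𝕂" => ℂ
section Summing

variable {E F : Type} [NormedAddCommGroup E] [NormedSpace 𝕂 E]
  [NormedAddCommGroup F] [NormedSpace 𝕂 F]

/-- The weak ℓ_q norm of a finite family of vectors:
`sup { (Σ_i ‖e*(e_i)‖^q)^(1/q) : e* ∈ E*, ‖e*‖ ≤ 1 }`. -/
def weakNorm (q : ℝ) {n : ℕ} (e : Fin n → E) : ℝ :=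
  ⨆ f : {f : StrongDual 𝕂 E // ‖f‖ ≤ 1}, (∑ i, ‖(f : StrongDual 𝕂 E) (e i)‖ ^ q) ^ (1 / q)

/-- `T` satisfies the (p,q)-summing inequality with constant `C`:
`(Σ_i ‖T e_i‖^p)^(1/p) ≤ C · sup { (Σ_i ‖e*(e_i)‖^q)^(1/q) : ‖e*‖ ≤ 1 }`
for all finite families `e_1, …, e_n`. -/
def SummingWithC (p q C : ℝ) (T : E →L[𝕂] F) : Prop :=
  ∀ (n : ℕ) (e : Fin n → E),
    (∑ i, ‖T (e i)‖ ^ p) ^ (1 / p) ≤ C * weakNorm q e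

/-- `T` is (p,q)-summing. -/
def IsPQSumming (p q : ℝ) (T : E →L[𝕂] F) : Prop :=
  ∃ C, 0 ≤ C ∧ SummingWithC p q C T

/-- `T` is p-summing. -/
def IsPSumming (p : ℝ) (T : E →L[𝕂] F) : Prop := IsPQSumming p p T

/-- The p-summing norm `π_p(T)`: the least admissible constant. -/
def pNorm (p : ℝ) (T : E →L[𝕂] F) : ℝ :=
  sInf {C | 0 ≤ C ∧ SummingWithC p p C T}

end Summing

/-- For `f : C(Ω, 𝕂)` and a vector `y`, the function `f ⊗ y : t ↦ f(t) • y`, under the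
identification `C(Ω) ⊗̂_ε H = C(Ω, H)`. -/
def cmSmul {Ω : Type} [TopologicalSpace Ω] {H : Type} [NormedAddCommGroup H]
    [NormedSpace 𝕂 H] (f : C(Ω, 𝕂)) (y : H) : C(Ω, H) :=
  ⟨fun t => f t • y, (map_continuous f).smul continuous_const⟩

attribute [local instance] MeasureTheory.Measure.Subtype.measureSpace

/-- The n-th Fourier coefficient `φ̂(n) = ∫₀¹ φ(t) e^{2πint} dt` (a Bochner integral) of a
continuous `ℓ₂(ℤ)`-valued function on `[0,1]`. -/
def fourierCoeffCM (φ : C(Set.Icc (0 : ℝ) 1, ↥(lp (fun _ : ℤ => ℂ) 2))) (n : ℤ) :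
    ↥(lp (fun _ : ℤ => ℂ) 2) :=
  ∫ t : Set.Icc (0 : ℝ) 1,
    Complex.exp (2 * Real.pi * Complex.I * (n : ℂ) * ((t : ℝ) : ℂ)) • φ t


open MeasureTheory
lemma khin4 (S : Finset ℤ) (a : ℤ → ℂ) :
    (∑ t ∈ S.powerset, ‖∑ n ∈ S, (if n ∈ t then (-1:ℂ) else 1) * a n‖ ^ 2
      = 2 ^ S.card * ∑ n ∈ S, ‖a n‖ ^ 2) ∧
    (∑ t ∈ S.powerset, ‖∑ n ∈ S, (if n ∈ t then (-1:ℂ) else 1) * a n‖ ^ 4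
      ≤ 2 ^ S.card * (3 * (∑ n ∈ S, ‖a n‖ ^ 2) ^ 2)) := by
  classical
  induction S using Finset.induction_on with
  | empty => simp
  | insert m S hm ih =>
    obtain ⟨ih2, ih4⟩ := ih
    have key : ∀ F : ℂ → ℝ, ∑ t ∈ (insert m S).powerset,
        F (∑ n ∈ insert m S, (if n ∈ t then (-1:ℂ) else 1) * a n) =
        ∑ t ∈ S.powerset, (F (a m + ∑ n ∈ S, (if n ∈ t then (-1:ℂ) else 1) * a n) +
          F (-a m + ∑ n ∈ S, (if n ∈ t then (-1:ℂ) else 1) * a n)) := by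
      intro F
      rw [Finset.sum_powerset_insert hm, ← Finset.sum_add_distrib]
      refine Finset.sum_congr rfl fun t ht => ?_
      have hmt : m ∉ t := fun h => hm (Finset.mem_powerset.1 ht h)
      rw [Finset.sum_insert hm, Finset.sum_insert hm]
      congr 3
      · simp [hmt]
      · simp
      · refine Finset.sum_congr rfl fun n hn => ?_
        have : n ≠ m := fun h => hm (h ▸ hn)
        simp [this]
    have par : ∀ x y : ℂ, ‖x + y‖ ^ 2 + ‖-x + y‖ ^ 2 = 2 * (‖x‖ ^ 2 + ‖y‖ ^ 2) := by
      intro x y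
      simp only [← Complex.normSq_eq_norm_sq, Complex.normSq_apply, Complex.add_re, Complex.add_im,
        Complex.neg_re, Complex.neg_im]
      ring
    have par4 : ∀ x y : ℂ, ‖x + y‖ ^ 4 + ‖-x + y‖ ^ 4 ≤
        2 * (‖x‖ ^ 4 + 6 * ‖x‖ ^ 2 * ‖y‖ ^ 2 + ‖y‖ ^ 4) := by
      intro x y
      have e : ∀ z : ℂ, ‖z‖ ^ 4 = (‖z‖ ^ 2) ^ 2 := fun z => by ring
      simp only [e]
      simp only [← Complex.normSq_eq_norm_sq, Complex.normSq_apply, Complex.add_re, Complex.add_im,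
        Complex.neg_re, Complex.neg_im]
      nlinarith [sq_nonneg (x.re * y.im - x.im * y.re)]
    constructor
    · rw [key (fun z => ‖z‖ ^ 2)]
      simp only [par]
      rw [← Finset.mul_sum, Finset.sum_add_distrib, ih2, Finset.sum_insert hm,
        Finset.card_insert_of_notMem hm, Finset.sum_const, Finset.card_powerset]
      simp only [nsmul_eq_mul]; push_cast; ring
    · rw [key (fun z => ‖z‖ ^ 4)]
      refine (Finset.sum_le_sum fun t _ => par4 _ _).trans ?_
      rw [← Finset.mul_sum, Finset.sum_add_distrib, Finset.sum_add_distrib, ← Finset.mul_sum, ih2,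
        Finset.sum_insert hm,
        Finset.card_insert_of_notMem hm, Finset.sum_const, Finset.card_powerset]
      simp only [nsmul_eq_mul]; push_cast
      have : (0:ℝ) < 2 ^ S.card := by positivity
      have h2 : (0:ℝ) ≤ 2 ^ S.card * ‖a m‖ ^ 4 := by positivity
      have e : (2:ℝ) ^ (S.card + 1) = 2 * 2 ^ S.card := by ring
      rw [e]
      nlinarith

lemma khinp (p : ℝ) (hp1 : 1 < p) (hp2 : p ≤ 2) (S : Finset ℤ) (a : ℤ → ℂ) :
    2 ^ S.card * (∑ n ∈ S, ‖a n‖ ^ 2) ^ (p / 2) ≤ 12 *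
      ∑ t ∈ S.powerset, ‖∑ n ∈ S, (if n ∈ t then (-1:ℂ) else 1) * a n‖ ^ p := by
  set A := ∑ n ∈ S, ‖a n‖ ^ 2 with hA
  have hA0 : 0 ≤ A := Finset.sum_nonneg fun _ _ => by positivity
  obtain h0 | hpos := hA0.eq_or_lt
  · rw [← h0, Real.zero_rpow (by positivity)]
    simp only [mul_zero]
    positivity
  obtain ⟨h2, h4⟩ := khin4 S a
  rw [← hA] at h2 h4
  have pt : ∀ t : ℝ, 0 ≤ t → A ^ (p/2) * (t ^ 2 * (6 * A - t ^ 2)) ≤ 36 * A ^ 2 * t ^ p := by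
    intro t ht
    by_cases h : 6 * A ≤ t ^ 2
    · refine le_trans (mul_nonpos_of_nonneg_of_nonpos (by positivity) (mul_nonpos_of_nonneg_of_nonpos (by positivity) (by linarith))) (by positivity)
    push Not at h
    obtain rfl | ht := ht.eq_or_lt
    · simp; positivity
    have e1 : t ^ 2 = t ^ p * (t ^ 2) ^ ((2 - p) / 2) := by
      rw [← Real.rpow_natCast t 2, ← Real.rpow_mul ht.le, ← Real.rpow_add ht]
      congr 1; push_cast; ring
    have e2 : (t ^ 2) ^ ((2 - p) / 2) ≤ (6 * A) ^ ((2 - p) / 2) :=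
      Real.rpow_le_rpow (by positivity) h.le (by linarith)
    have e3 : (6 * A) ^ ((2 - p) / 2) ≤ 6 * A ^ ((2 - p) / 2) := by
      rw [Real.mul_rpow (by norm_num) hA0]
      gcongr
      calc (6:ℝ) ^ ((2 - p) / 2) ≤ 6 ^ (1:ℝ) := Real.rpow_le_rpow_of_exponent_le (by norm_num) (by linarith)
        _ = 6 := by simp
    have e4 : A ^ (p/2) * A ^ ((2-p)/2) = A := by
      rw [← Real.rpow_add hpos]; convert Real.rpow_one A using 2; ring
    calc A ^ (p/2) * (t ^ 2 * (6 * A - t ^ 2)) ≤ A ^ (p/2) * (t ^ 2 * (6 * A)) := by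
          gcongr; nlinarith
      _ ≤ A ^ (p/2) * ((t ^ p * (6 * A ^ ((2 - p) / 2))) * (6 * A)) := by
          gcongr
          calc t ^ 2 = t ^ p * (t ^ 2) ^ ((2 - p) / 2) := e1
            _ ≤ _ := by gcongr; exact e2.trans e3
      _ = 36 * (A ^ (p/2) * A ^ ((2-p)/2)) * A * t ^ p := by ring
      _ = _ := by rw [e4]; ring
  have hs := Finset.sum_le_sum fun t (_ : t ∈ S.powerset) =>
    pt ‖∑ n ∈ S, (if n ∈ t then (-1:ℂ) else 1) * a n‖ (norm_nonneg _)
  rw [← Finset.mul_sum, ← Finset.mul_sum] at hs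
  set Q := ∑ t ∈ S.powerset, ‖∑ n ∈ S, (if n ∈ t then (-1:ℂ) else 1) * a n‖ ^ p
  have e5 : 2 ^ S.card * (3 * A ^ 2) ≤ ∑ t ∈ S.powerset, ‖∑ n ∈ S, (if n ∈ t then (-1:ℂ) else 1) * a n‖ ^ 2 *
      (6 * A - ‖∑ n ∈ S, (if n ∈ t then (-1:ℂ) else 1) * a n‖ ^ 2) := by
    have : ∀ x : ℝ, x ^ 2 * (6 * A - x ^ 2) = 6 * A * x ^ 2 - x ^ 4 := fun x => by ring
    simp only [this]
    rw [Finset.sum_sub_distrib, ← Finset.mul_sum, h2]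
    nlinarith
  have e6 := (mul_le_mul_of_nonneg_left e5 (by positivity : 0 ≤ A ^ (p/2))).trans hs
  have : 3 * A ^ 2 * (2 ^ S.card * A ^ (p/2)) ≤ 3 * A ^ 2 * (12 * Q) := by linarith
  exact le_of_mul_le_mul_left this (by positivity)

lemma geom_aux (u : ℝ) (K : ℕ) :
    ∑ k ∈ Finset.range K, (if u ≤ 4 ^ k then u * (4 ^ k)⁻¹ else 0) ≤
      max 0 (4 / 3 * (1 - u * (4 ^ K)⁻¹)) := by
  induction K with
  | zero => simp
  | succ K ih =>
    rw [Finset.sum_range_succ]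
    split_ifs with h
    · have h1 : u * (4 ^ K)⁻¹ ≤ 1 := by
        rw [← div_eq_mul_inv, div_le_one (by positivity)]; exact h
      rw [max_eq_right (by linarith)] at ih
      refine le_max_of_le_right ?_
      rw [pow_succ, mul_inv]
      linarith
    · push Not at h
      have h1 : 1 ≤ u * (4 ^ K)⁻¹ := by
        rw [← div_eq_mul_inv, one_le_div (by positivity)]; exact h.le
      rw [max_eq_left (by linarith)] at ih
      refine le_max_of_le_left ?_
      linarith

abbrev I01 := Set.Icc (0:ℝ) 1

lemma isProb : IsProbabilityMeasure (volume : Measure I01) := by infer_instance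

def EE (n : ℤ) (t : I01) : ℂ := Complex.exp (2 * Real.pi * Complex.I * (n : ℂ) * ((t : ℝ) : ℂ))

lemma EE_cont (n : ℤ) : Continuous (EE n) := by unfold EE; fun_prop
lemma EE_norm (n : ℤ) (t : I01) : ‖EE n t‖ = 1 := by
  have : (2 * Real.pi * Complex.I * (n : ℂ) * ((t : ℝ) : ℂ)) = ((2 * Real.pi * n * t : ℝ) : ℂ) * Complex.I := by
    push_cast; ring
  rw [EE, this, Complex.norm_exp_ofReal_mul_I]

lemma EE_conj_mul (n m : ℤ) (t : I01) : EE n t * (starRingEnd ℂ) (EE m t) = EE (n - m) t := by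
  simp only [EE]
  rw [← Complex.exp_conj, ← Complex.exp_add]
  congr 1
  have : (starRingEnd ℂ) 2 = 2 := Complex.conj_ofNat 2
  simp [this]
  ring

lemma EE_int (n : ℤ) : ∫ t : I01, EE n t = if n = 0 then 1 else 0 := by
  have h := integral_subtype_comap (μ := volume) (measurableSet_Icc (a := (0:ℝ)) (b := 1))
    (fun t : ℝ => Complex.exp (2 * Real.pi * Complex.I * (n : ℂ) * (t : ℂ)))
  have h' : ∫ t : I01, EE n t = ∫ t in Set.Icc (0:ℝ) 1, Complex.exp (2 * Real.pi * Complex.I * (n : ℂ) * (t : ℂ)) := h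
  rw [h', integral_Icc_eq_integral_Ioc, ← intervalIntegral.integral_of_le zero_le_one]
  split_ifs with hn
  · simp [hn]
  · have hc : (2 * Real.pi * Complex.I * (n : ℂ)) ≠ 0 := by simp [hn, Real.pi_ne_zero]
    rw [integral_exp_mul_complex hc]
    have : Complex.exp (2 * Real.pi * Complex.I * n * ((1:ℝ):ℂ)) = 1 := by
      rw [Complex.exp_eq_one_iff]; exact ⟨n, by push_cast; ring⟩
    rw [this]; simp

def cE (n : ℤ) : C(I01, ℂ) := ⟨fun t => (starRingEnd ℂ) (EE n t), Complex.continuous_conj.comp (EE_cont n)⟩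

lemma cE_mem (n : ℤ) : MemLp (cE n : I01 → ℂ) 2 (volume : Measure I01) :=
  MemLp.of_bound (cE n).continuous.aestronglyMeasurable 1 (Filter.Eventually.of_forall fun t => by
    simp [cE, EE_norm])

lemma orth : Orthonormal ℂ (fun n => (cE_mem n).toLp) := by
  rw [orthonormal_iff_ite]
  intro i j
  rw [L2.inner_def]
  have : (fun t => inner ℂ (((cE_mem i).toLp _ : Lp ℂ 2 (volume : Measure I01)) t) (((cE_mem j).toLp _ : Lp ℂ 2 (volume : Measure I01)) t)) =ᵐ[volume] fun t => EE (i - j) t := by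
    filter_upwards [(cE_mem i).coeFn_toLp, (cE_mem j).coeFn_toLp] with t h1 h2
    rw [h1, h2, ← EE_conj_mul]
    simp [cE, mul_comm]
  rw [integral_congr_ae this, EE_int]
  simp [sub_eq_zero]

lemma bessel (g : I01 → ℂ) (hg : MemLp g 2 (volume : Measure I01)) (N : Finset ℤ) :
    ∑ n ∈ N, ‖∫ t, EE n t * g t‖ ^ 2 ≤ ∫ t, ‖g t‖ ^ 2 := by
  have h := orth.sum_inner_products_le (s := N) hg.toLp
  have h1 : ∀ n, inner ℂ ((cE_mem n).toLp) (hg.toLp) = ∫ t, EE n t * g t := by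
    intro n
    rw [L2.inner_def]
    refine integral_congr_ae ?_
    filter_upwards [(cE_mem n).coeFn_toLp, hg.coeFn_toLp] with t h1 h2
    rw [h1, h2]
    simp [cE, mul_comm]
  simp only [h1] at h
  refine h.trans (le_of_eq ?_)
  rw [@norm_sq_eq_re_inner ℂ, L2.inner_def]
  have : (∫ t, inner ℂ ((hg.toLp g : Lp ℂ 2 (volume : Measure I01)) t) ((hg.toLp g : Lp ℂ 2 (volume : Measure I01)) t)) = ((∫ t, ‖g t‖ ^ 2 : ℝ) : ℂ) := by
    refine Eq.trans ?_ (integral_ofReal (𝕜 := ℂ))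
    refine integral_congr_ae ?_
    filter_upwards [hg.coeFn_toLp] with t h2
    rw [h2, inner_self_eq_norm_sq_to_K]; simp
  rw [this]
  simp

lemma hy_main (p : ℝ) (hp1 : 1 < p) (hp2 : p < 2) (r : ℝ) (hr : r = 2 * p / (2 - p))
    (lam : ℤ → ℂ) (hlam : ∀ n, ‖lam n‖ ≤ 1) (L : ℝ)
    (hL : ∀ N : Finset ℤ, ∑ n ∈ N, ‖lam n‖ ^ r ≤ L)
    (f : C(I01, ℂ)) (hf : ∫ t, ‖f t‖ ^ p ≤ 1) (N : Finset ℤ) :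
    ∑ n ∈ N, ‖lam n * ∫ t, EE n t * f t‖ ^ 2 ≤ 8 / 3 + 2 * 2 ^ r * L := by
  classical
  have h2p : 0 < 2 - p := by linarith
  have hfc : Continuous fun t => ‖f t‖ := by fun_prop
  have hfp : Continuous fun t => ‖f t‖ ^ p := hfc.rpow_const (fun _ => Or.inr (by linarith))
  have hfu : Continuous fun t => ‖f t‖ ^ (2 - p) := hfc.rpow_const (fun _ => Or.inr (by linarith))
  have hfpi : Integrable (fun t => ‖f t‖ ^ p) (volume : Measure I01) :=
    hfp.integrable_of_hasCompactSupport (HasCompactSupport.of_compactSpace _)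
  let g : ℕ → I01 → ℂ := fun k t => if ‖f t‖ ^ (2 - p) ≤ 4 ^ k then f t else 0
  have hgm : ∀ k, Measurable (g k) := fun k =>
    Measurable.ite (measurableSet_le hfu.measurable measurable_const) f.continuous.measurable measurable_const
  have hgb : ∀ k t, ‖g k t‖ ≤ ‖f‖ := by
    intro k t
    simp only [g]
    split_ifs
    · exact f.norm_coe_le_norm t
    · simp
  have hg2 : ∀ k, MemLp (g k) 2 (volume : Measure I01) := fun k =>
    MemLp.of_bound (hgm k).aestronglyMeasurable ‖f‖ (Filter.Eventually.of_forall (hgb k))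
  have hgi : ∀ k, Integrable (g k) (volume : Measure I01) := fun k =>
    (hg2 k).integrable (by norm_num)
  have hfi : Integrable (fun t => f t) (volume : Measure I01) :=
    f.continuous.integrable_of_hasCompactSupport (HasCompactSupport.of_compactSpace _)
  have hEi : ∀ n (h : I01 → ℂ), Integrable h → Integrable (fun t => EE n t * h t) := fun n h hh =>
    hh.bdd_mul (c := 1) (EE_cont n).aestronglyMeasurable
      (Filter.Eventually.of_forall fun t => (EE_norm n t).le)
  -- the large part
  have hbig : ∀ (k : ℕ) (n : ℤ), ‖∫ t, EE n t * (f t - g k t)‖ ≤ ((4:ℝ) ^ k) ^ ((1 - p) / (2 - p)) := by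
    intro k n
    calc ‖∫ t, EE n t * (f t - g k t)‖ ≤ ∫ t, ‖EE n t * (f t - g k t)‖ := norm_integral_le_integral_norm _
      _ ≤ ∫ t, ((4:ℝ) ^ k) ^ ((1 - p) / (2 - p)) * ‖f t‖ ^ p := by
          refine integral_mono ((hEi n _ (hfi.sub (hgi k))).norm) (hfpi.const_mul _) fun t => ?_
          simp only [norm_mul, EE_norm, one_mul, g]
          split_ifs with h
          · simp; positivity
          · push Not at h
            rw [sub_zero]
            have h4 : (0:ℝ) < 4 ^ k := by positivity
            have hpos : 0 < ‖f t‖ := by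
              rcases (norm_nonneg (f t)).eq_or_lt with h0 | h0
              · rw [← h0, Real.zero_rpow h2p.ne'] at h
                linarith
              · exact h0
            have e := Real.rpow_le_rpow_of_nonpos h4 h.le
              (z := (1 - p) / (2 - p)) (div_nonpos_of_nonpos_of_nonneg (by linarith) h2p.le)
            rw [← Real.rpow_mul hpos.le, mul_div_cancel₀ _ h2p.ne'] at e
            calc ‖f t‖ = ‖f t‖ ^ (1 - p) * ‖f t‖ ^ p := by
                  rw [← Real.rpow_add hpos]; simp
              _ ≤ _ := by gcongr
      _ = ((4:ℝ) ^ k) ^ ((1 - p) / (2 - p)) * ∫ t, ‖f t‖ ^ p := integral_const_mul _ _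
      _ ≤ _ := mul_le_of_le_one_right (by positivity) hf
  have hexp : ∀ k : ℕ, ((4:ℝ) ^ k)⁻¹ * (((4:ℝ) ^ k) ^ ((1 - p) / (2 - p))) ^ 2 = (((1/2:ℝ)) ^ k) ^ r := by
    intro k
    have e4 : (4:ℝ) ^ k = (2:ℝ) ^ (2 * k : ℝ) := by
      rw [Real.rpow_mul (by norm_num), Real.rpow_natCast]; norm_num
    have e2 : (1/2:ℝ) ^ k = (2:ℝ) ^ (-k : ℝ) := by
      rw [Real.rpow_neg (by norm_num), Real.rpow_natCast]; simp
    rw [e4, e2, ← Real.rpow_mul (by norm_num), ← Real.rpow_mul (by norm_num), ← Real.rpow_natCast,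
      ← Real.rpow_mul (by norm_num), ← Real.rpow_neg (by norm_num), ← Real.rpow_add (by norm_num)]
    congr 1
    rw [hr]; field_simp; push_cast; ring
  have hrpos : 0 < r := by rw [hr]; positivity
  have hkex : ∀ n, ∃ k : ℕ, lam n ≠ 0 → (1/2:ℝ) ^ (k + 1) < ‖lam n‖ ∧ ‖lam n‖ ≤ (1/2:ℝ) ^ k := by
    intro n
    by_cases h : lam n = 0
    · exact ⟨0, fun h' => absurd h h'⟩
    · obtain ⟨k, hk⟩ := exists_nat_pow_near_of_lt_one (norm_pos_iff.2 h) (hlam n)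
        (by norm_num : (0:ℝ) < 1/2) (by norm_num)
      exact ⟨k, fun _ => hk⟩
  choose κ hκ using hkex
  have hterm : ∀ n, ‖lam n * ∫ t, EE n t * f t‖ ^ 2 ≤
      2 * ((4:ℝ) ^ κ n)⁻¹ * ‖∫ t, EE n t * g (κ n) t‖ ^ 2 + 2 * 2 ^ r * ‖lam n‖ ^ r := by
    intro n
    by_cases h : lam n = 0
    · rw [h, zero_mul, norm_zero, zero_pow two_ne_zero]; positivity
    obtain ⟨h1, h2⟩ := hκ n h
    set k := κ n
    have hsplit : ∫ t, EE n t * f t = (∫ t, EE n t * g k t) + ∫ t, EE n t * (f t - g k t) := by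
      refine Eq.trans ?_ (integral_add (hEi n _ (hgi k)) (hEi n _ (hfi.sub (hgi k))))
      refine integral_congr_ae (Filter.Eventually.of_forall fun t => ?_)
      change EE n t * f t = EE n t * g k t + EE n t * (f t - g k t)
      ring
    set a := ∫ t, EE n t * g k t
    set b := ∫ t, EE n t * (f t - g k t) with hb
    have hb' := hbig k n
    rw [← hb] at hb'
    have e4 : ((1/2:ℝ) ^ k) ^ 2 = ((4:ℝ) ^ k)⁻¹ := by
      rw [← pow_mul, mul_comm, pow_mul, ← inv_pow]; norm_num
    have e5 : ((1/2:ℝ) ^ k) ^ r ≤ 2 ^ r * ‖lam n‖ ^ r := by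
      rw [← Real.mul_rpow (by norm_num) (norm_nonneg _)]
      refine Real.rpow_le_rpow (by positivity) ?_ hrpos.le
      rw [pow_succ] at h1; linarith
    rw [hsplit, norm_mul, mul_pow]
    have e6 : ‖a + b‖ ^ 2 ≤ 2 * ‖a‖ ^ 2 + 2 * ‖b‖ ^ 2 := by
      have := norm_add_le a b
      nlinarith [norm_nonneg (a + b), sq_nonneg (‖a‖ - ‖b‖)]
    have e7 : ‖lam n‖ ^ 2 ≤ ((4:ℝ) ^ k)⁻¹ := by rw [← e4]; gcongr
    have e8 : ‖b‖ ^ 2 ≤ (((4:ℝ) ^ k) ^ ((1 - p) / (2 - p))) ^ 2 := by gcongr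
    have h4 : (0:ℝ) < ((4:ℝ) ^ k)⁻¹ := by positivity
    have e9 : ((4:ℝ) ^ k)⁻¹ * ‖b‖ ^ 2 ≤ 2 ^ r * ‖lam n‖ ^ r := by
      refine le_trans ?_ e5
      rw [← hexp k]; gcongr
    calc ‖lam n‖ ^ 2 * ‖a + b‖ ^ 2 ≤ ((4:ℝ) ^ k)⁻¹ * (2 * ‖a‖ ^ 2 + 2 * ‖b‖ ^ 2) := by gcongr
      _ ≤ _ := by linarith
  refine (Finset.sum_le_sum fun n _ => hterm n).trans ?_
  rw [Finset.sum_add_distrib, ← Finset.mul_sum]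
  have hfirst : ∑ n ∈ N, 2 * ((4:ℝ) ^ κ n)⁻¹ * ‖∫ t, EE n t * g (κ n) t‖ ^ 2 ≤ 8 / 3 := by
    obtain ⟨K, hK⟩ : ∃ K : ℕ, ∀ n ∈ N, κ n ∈ Finset.range K :=
      ⟨N.sup κ + 1, fun n hn => Finset.mem_range.2 (Nat.lt_succ_of_le (Finset.le_sup hn))⟩
    rw [← Finset.sum_fiberwise_of_maps_to hK]
    have hgsq : ∀ k, Integrable (fun t => ‖g k t‖ ^ 2) (volume : Measure I01) := fun k =>
      (hg2 k).integrable_norm_pow (by norm_num)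
    calc _ ≤ ∑ k ∈ Finset.range K, 2 * ((4:ℝ) ^ k)⁻¹ * ∫ t, ‖g k t‖ ^ 2 := by
          refine Finset.sum_le_sum fun k _ => ?_
          have : ∑ n ∈ N with κ n = k, 2 * ((4:ℝ) ^ κ n)⁻¹ * ‖∫ t, EE n t * g (κ n) t‖ ^ 2 =
            ∑ n ∈ N with κ n = k, 2 * ((4:ℝ) ^ k)⁻¹ * ‖∫ t, EE n t * g k t‖ ^ 2 :=
            Finset.sum_congr rfl fun n hn => by rw [(Finset.mem_filter.1 hn).2]
          rw [this, ← Finset.mul_sum]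
          gcongr
          exact bessel _ (hg2 k) _
      _ = ∫ t, ∑ k ∈ Finset.range K, 2 * ((4:ℝ) ^ k)⁻¹ * ‖g k t‖ ^ 2 := by
          rw [integral_finset_sum _ fun k _ => (hgsq k).const_mul _]
          simp only [integral_const_mul]
      _ ≤ ∫ t, 8 / 3 * ‖f t‖ ^ p := by
          refine integral_mono (integrable_finset_sum _ fun k _ => (hgsq k).const_mul _)
            (hfpi.const_mul _) fun t => ?_
          have hu : 0 ≤ ‖f t‖ ^ (2 - p) := by positivity
          have h1 := geom_aux (‖f t‖ ^ (2 - p)) K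
          have h2 : max 0 (4 / 3 * (1 - ‖f t‖ ^ (2 - p) * ((4:ℝ) ^ K)⁻¹)) ≤ 4 / 3 := by
            have : 0 ≤ ‖f t‖ ^ (2 - p) * ((4:ℝ) ^ K)⁻¹ := by positivity
            exact max_le (by norm_num) (by linarith)
          have h3 : ‖f t‖ ^ 2 = ‖f t‖ ^ p * ‖f t‖ ^ (2 - p) := by
            rw [← Real.rpow_add' (norm_nonneg _) (by norm_num), ← Real.rpow_natCast]
            congr 1; push_cast; ring
          calc ∑ k ∈ Finset.range K, 2 * ((4:ℝ) ^ k)⁻¹ * ‖g k t‖ ^ 2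
              = 2 * ‖f t‖ ^ p * ∑ k ∈ Finset.range K, (if ‖f t‖ ^ (2 - p) ≤ 4 ^ k then
                  ‖f t‖ ^ (2 - p) * (4 ^ k)⁻¹ else 0) := by
                rw [Finset.mul_sum]
                refine Finset.sum_congr rfl fun k _ => ?_
                simp only [g]
                split_ifs
                · rw [h3]; ring
                · simp
            _ ≤ 2 * ‖f t‖ ^ p * (4 / 3) := by gcongr; exact h1.trans h2
            _ = _ := by ring
      _ = 8 / 3 * ∫ t, ‖f t‖ ^ p := integral_const_mul _ _
      _ ≤ 8 / 3 := by linarith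
  have := mul_le_mul_of_nonneg_left (hL N) (by positivity : (0:ℝ) ≤ 2 * 2 ^ r)
  linarith

lemma hy_hom (p : ℝ) (hp1 : 1 < p) (lam : ℤ → ℂ) (M : ℝ)
    (h : ∀ (f : C(I01, ℂ)), ∫ t, ‖f t‖ ^ p ≤ 1 → ∀ N : Finset ℤ,
      ∑ n ∈ N, ‖lam n * ∫ t, EE n t * f t‖ ^ 2 ≤ M ^ 2)
    (f : C(I01, ℂ)) (N : Finset ℤ) :
    ∑ n ∈ N, ‖lam n * ∫ t, EE n t * f t‖ ^ 2 ≤ (M * (∫ t, ‖f t‖ ^ p) ^ (1 / p)) ^ 2 := by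
  have hfp : Continuous fun t => ‖f t‖ ^ p :=
    (by fun_prop : Continuous fun t => ‖f t‖).rpow_const (fun _ => Or.inr (by linarith))
  have hfpi : Integrable (fun t => ‖f t‖ ^ p) (volume : Measure I01) :=
    hfp.integrable_of_hasCompactSupport (HasCompactSupport.of_compactSpace _)
  have h0 : 0 ≤ ∫ t, ‖f t‖ ^ p := integral_nonneg fun t => by positivity
  set A := ∫ t, ‖f t‖ ^ p with hA
  obtain h0 | hpos := h0.eq_or_lt
  · have hz : (fun t => ‖f t‖ ^ p) =ᵐ[volume] 0 :=
      (integral_eq_zero_iff_of_nonneg (fun t => by positivity) hfpi).1 (hA.symm.trans h0.symm)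
    have : ∀ n, ∫ t, EE n t * f t = 0 := by
      intro n
      refine integral_eq_zero_of_ae ?_
      filter_upwards [hz] with t ht
      have : f t = 0 := by
        have := (Real.rpow_eq_zero (norm_nonneg (f t)) (by linarith)).1 ht
        exact norm_eq_zero.1 this
      simp [this]
    simp only [this, mul_zero, norm_zero]
    simp only [ne_eq, OfNat.ofNat_ne_zero, not_false_eq_true, zero_pow, Finset.sum_const_zero]
    positivity
  · set B := A ^ (1 / p) with hB
    have hBp : 0 < B := by positivity
    have hBB : B ^ p = A := by
      rw [hB, ← Real.rpow_mul hpos.le]; field_simp; simp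
    have key := h (((B⁻¹ : ℝ) : ℂ) • f) (by
      have : ∀ t, ‖(((B⁻¹ : ℝ) : ℂ) • f) t‖ ^ p = A⁻¹ * ‖f t‖ ^ p := by
        intro t
        rw [ContinuousMap.smul_apply, norm_smul, Real.mul_rpow (norm_nonneg _) (norm_nonneg _),
          Complex.norm_real, Real.norm_of_nonneg (by positivity), Real.inv_rpow hBp.le, hBB]
      simp only [this]
      rw [integral_const_mul, ← hA, inv_mul_cancel₀ hpos.ne']) N
    have e : ∀ n, ‖lam n * ∫ t, EE n t * (((B⁻¹ : ℝ) : ℂ) • f) t‖ ^ 2 =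
        (B⁻¹) ^ 2 * ‖lam n * ∫ t, EE n t * f t‖ ^ 2 := by
      intro n
      have : ∀ t, EE n t * (((B⁻¹ : ℝ) : ℂ) • f) t = ((B⁻¹ : ℝ) : ℂ) * (EE n t * f t) := by
        intro t; rw [ContinuousMap.smul_apply, smul_eq_mul]; ring
      simp only [this]
      rw [integral_const_mul, mul_left_comm, norm_mul, mul_pow, Complex.norm_real,
        Real.norm_of_nonneg (by positivity)]
    simp only [e] at key
    rw [← Finset.mul_sum, inv_pow, inv_mul_le_iff₀ (by positivity)] at key
    rw [mul_pow]; linarith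

section wk
variable {E F : Type} [NormedAddCommGroup E] [NormedSpace ℂ E]

lemma weak_bdd (p : ℝ) (hp : 1 < p) {n : ℕ} (e : Fin n → E) :
    BddAbove (Set.range fun f : {f : StrongDual ℂ E // ‖f‖ ≤ 1} =>
      (∑ i, ‖(f : StrongDual ℂ E) (e i)‖ ^ p) ^ (1 / p)) := by
  refine ⟨(∑ i, ‖e i‖ ^ p) ^ (1 / p), ?_⟩
  rintro _ ⟨⟨f, hf⟩, rfl⟩
  dsimp only
  gcongr with i
  exact (f.le_opNorm _).trans (mul_le_of_le_one_left (norm_nonneg _) hf)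

lemma weak_nonneg (p : ℝ) {n : ℕ} (e : Fin n → E) : 0 ≤ weakNorm p e :=
  Real.iSup_nonneg fun _ => by positivity

lemma weak_le_one (p : ℝ) (hp : 1 < p) {n : ℕ} (e : Fin n → E) (f : StrongDual ℂ E) (hf : ‖f‖ ≤ 1) :
    ∑ i, ‖f (e i)‖ ^ p ≤ weakNorm p e ^ p := by
  have h := le_ciSup (weak_bdd p hp e) ⟨f, hf⟩
  have h0 : 0 ≤ ∑ i, ‖f (e i)‖ ^ p := Finset.sum_nonneg fun _ _ => by positivity
  have h1 := Real.rpow_le_rpow (by positivity) h (by linarith : 0 ≤ p)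
  dsimp only at h1
  rw [← Real.rpow_mul h0, one_div_mul_cancel (by linarith), Real.rpow_one] at h1
  exact h1

lemma weak_le (p : ℝ) (hp : 1 < p) {n : ℕ} (e : Fin n → E) (f : StrongDual ℂ E) (B : ℝ)
    (hf : ‖f‖ ≤ B) :
    ∑ i, ‖f (e i)‖ ^ p ≤ (B * weakNorm p e) ^ p := by
  have hB : 0 ≤ B := (norm_nonneg _).trans hf
  obtain rfl | hpos := hB.eq_or_lt
  · have : f = 0 := norm_le_zero_iff.1 hf
    simp [this, Real.zero_rpow (by linarith : p ≠ 0)]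
  have h := weak_le_one p hp e (((B⁻¹ : ℝ) : ℂ) • f) (by
    rw [norm_smul, Complex.norm_real, Real.norm_of_nonneg (by positivity), inv_mul_le_iff₀ hpos]
    simpa using hf)
  have e1 : ∀ i, ‖(((B⁻¹ : ℝ) : ℂ) • f) (e i)‖ ^ p = (B ^ p)⁻¹ * ‖f (e i)‖ ^ p := by
    intro i
    rw [ContinuousLinearMap.smul_apply, norm_smul, Complex.norm_real,
      Real.norm_of_nonneg (by positivity), Real.mul_rpow (by positivity) (by positivity),
      Real.inv_rpow hB]
  simp only [e1] at h
  rw [← Finset.mul_sum, inv_mul_le_iff₀ (by positivity)] at h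
  rw [Real.mul_rpow hB (weak_nonneg p e)]
  exact h
end wk

abbrev l2Z := ↥(lp (fun _ : ℤ => ℂ) 2)

lemma l2_sum_le (y : l2Z) (N : Finset ℤ) : ∑ n ∈ N, ‖y n‖ ^ 2 ≤ ‖y‖ ^ 2 := by
  have := lp.sum_rpow_le_norm_rpow (p := 2) (by norm_num) y N
  simpa using this

lemma diag_summing (p : ℝ) (hp1 : 1 < p) (hp2 : p ≤ 2) (D : l2Z →L[ℂ] l2Z) (d : ℤ → ℂ)
    (hD : ∀ y n, (D y : ℤ → ℂ) n = d n * y n) (B : ℝ) (hB : 0 ≤ B)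
    (hd : ∀ N : Finset ℤ, ∑ n ∈ N, ‖d n‖ ^ 2 ≤ B ^ 2) :
    SummingWithC p p (12 ^ (1 / p) * B) D := by
  classical
  intro m x
  have hw := weak_nonneg p x
  have hfin : ∀ N : Finset ℤ, ∑ i, (∑ n ∈ N, ‖(D (x i) : ℤ → ℂ) n‖ ^ 2) ^ (p / 2) ≤
      12 * (B * weakNorm p x) ^ p := by
    intro N
    let φ : Finset ℤ → StrongDual ℂ l2Z := fun t =>
      ∑ n ∈ N, ((if n ∈ t then (-1:ℂ) else 1) * d n) • lp.evalCLM ℂ (fun _ : ℤ => ℂ) 2 n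
    have hφ : ∀ t y, φ t y = ∑ n ∈ N, (if n ∈ t then (-1:ℂ) else 1) * (D y : ℤ → ℂ) n := by
      intro t y
      simp only [φ, ContinuousLinearMap.sum_apply, ContinuousLinearMap.smul_apply, hD, smul_eq_mul,
        mul_assoc]
      rfl
    have hφn : ∀ t, ‖φ t‖ ≤ B := by
      intro t
      refine ContinuousLinearMap.opNorm_le_bound _ hB fun y => ?_
      rw [hφ]
      have h1 : ‖∑ n ∈ N, (if n ∈ t then (-1:ℂ) else 1) * (D y : ℤ → ℂ) n‖ ≤ ∑ n ∈ N, ‖d n‖ * ‖y n‖ := by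
        refine (norm_sum_le _ _).trans (Finset.sum_le_sum fun n _ => ?_)
        rw [hD, norm_mul, norm_mul]
        split_ifs <;> simp
      have h2 := Finset.sum_mul_sq_le_sq_mul_sq N (fun n => ‖d n‖) (fun n => ‖y n‖)
      have h3 : (∑ n ∈ N, ‖d n‖ * ‖y n‖) ^ 2 ≤ (B * ‖y‖) ^ 2 := by
        rw [mul_pow]
        refine h2.trans ?_
        gcongr
        · exact hd N
        · exact l2_sum_le y N
      exact h1.trans (abs_le_of_sq_le_sq' h3 (by positivity)).2
    have h4 : 2 ^ N.card * ∑ i, (∑ n ∈ N, ‖(D (x i) : ℤ → ℂ) n‖ ^ 2) ^ (p / 2) ≤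
        2 ^ N.card * (12 * (B * weakNorm p x) ^ p) := by
      calc _ ≤ ∑ i, 12 * ∑ t ∈ N.powerset, ‖φ t (x i)‖ ^ p := by
            rw [Finset.mul_sum]
            refine Finset.sum_le_sum fun i _ => ?_
            simp only [hφ]
            exact khinp p hp1 hp2 N (fun n => (D (x i) : ℤ → ℂ) n)
        _ = 12 * ∑ t ∈ N.powerset, ∑ i, ‖φ t (x i)‖ ^ p := by
            rw [← Finset.mul_sum, Finset.sum_comm]
        _ ≤ 12 * ∑ t ∈ N.powerset, (B * weakNorm p x) ^ p := by
            gcongr with t ht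
            exact weak_le p hp1 x (φ t) B (hφn t)
        _ = _ := by
            rw [Finset.sum_const, Finset.card_powerset, nsmul_eq_mul]; push_cast; ring
    exact le_of_mul_le_mul_left h4 (by positivity)
  have hlim : ∑ i, ‖D (x i)‖ ^ p ≤ 12 * (B * weakNorm p x) ^ p := by
    have ht : Filter.Tendsto (fun N : Finset ℤ => ∑ i, (∑ n ∈ N, ‖(D (x i) : ℤ → ℂ) n‖ ^ 2) ^ (p / 2))
        Filter.atTop (nhds (∑ i, (‖D (x i)‖ ^ 2) ^ (p / 2))) := by
      refine tendsto_finset_sum _ fun i _ => ?_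
      have h := lp.hasSum_norm (p := 2) (by norm_num) (D (x i))
      have h' : HasSum (fun n => ‖(D (x i) : ℤ → ℂ) n‖ ^ 2) (‖D (x i)‖ ^ 2) := by simpa using h
      exact Filter.Tendsto.rpow_const h' (Or.inr (by linarith))
    have := le_of_tendsto' ht hfin
    refine le_trans (le_of_eq (Finset.sum_congr rfl fun i _ => ?_)) this
    rw [← Real.rpow_natCast, ← Real.rpow_mul (norm_nonneg _)]
    congr 1; push_cast; ring
  have h5 := Real.rpow_le_rpow (Finset.sum_nonneg fun _ _ => by positivity) hlim
    (by positivity : 0 ≤ 1 / p)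
  rwa [Real.mul_rpow (by norm_num) (by positivity), ← Real.rpow_mul (by positivity),
    mul_one_div_cancel (by linarith), Real.rpow_one, ← mul_assoc] at h5

def tens (f : C(I01, ℂ)) : l2Z →L[ℂ] C(I01, l2Z) :=
  LinearMap.mkContinuous
    { toFun := fun y => cmSmul f y
      map_add' := fun x y => by ext1 t; exact smul_add (f t) x y
      map_smul' := fun c y => by ext1 t; exact smul_comm (f t) c y }
    ‖f‖ (fun y => by
      refine (ContinuousMap.norm_le _ (by positivity)).2 fun t => ?_
      change ‖f t • y‖ ≤ _
      rw [norm_smul]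
      gcongr
      exact f.norm_coe_le_norm t)

lemma four_tens (f : C(I01, ℂ)) (y : l2Z) (n : ℤ) :
    (fourierCoeffCM (cmSmul f y) n : ℤ → ℂ) n = (∫ t, EE n t * f t) * y n := by
  have : fourierCoeffCM (cmSmul f y) n = (∫ t, EE n t * f t) • y := by
    rw [← integral_smul_const]
    unfold fourierCoeffCM
    congr 1
    ext1 t
    rw [mul_smul]; rfl
  rw [this]
  rfl

lemma hy_final (p : ℝ) (r : ℝ≥0∞) [Fact (1 ≤ r)] (hp1 : 1 < p) (hp2 : p ≤ 2)
    (hpr : 1 / ENNReal.ofReal p = 1 / r + 1 / 2)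
    (lam : ↥(lp (fun _ : ℤ => ℂ) r)) (hlam : ∀ n : ℤ, ‖lam n‖ ≤ 1) :
    ∃ M : ℝ, 0 ≤ M ∧ ∀ (f : C(I01, ℂ)) (N : Finset ℤ),
      ∑ n ∈ N, ‖lam n * ∫ t, EE n t * f t‖ ^ 2 ≤ (M * (∫ t, ‖f t‖ ^ p) ^ (1 / p)) ^ 2 := by
  obtain hp2 | rfl := hp2.lt_or_eq
  · have hr0 : r ≠ 0 := fun h => by
      have : (1:ℝ≥0∞) ≤ r := Fact.out
      simp [h] at this
    have hrt : r ≠ ⊤ := by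
      rintro rfl
      have h := congrArg ENNReal.toReal hpr
      simp [ENNReal.toReal_ofReal (by linarith : 0 ≤ p)] at h
      linarith
    have hrpos : 0 < r.toReal := ENNReal.toReal_pos hr0 hrt
    have hrr : r.toReal = 2 * p / (2 - p) := by
      have h := congrArg ENNReal.toReal hpr
      rw [ENNReal.toReal_add (by simp [hr0]) (by simp)] at h
      simp [ENNReal.toReal_ofReal (by linarith : 0 ≤ p)] at h
      have : 2 - p ≠ 0 := by linarith
      field_simp at h ⊢
      linarith
    have hL : ∀ N : Finset ℤ, ∑ n ∈ N, ‖lam n‖ ^ r.toReal ≤ ‖lam‖ ^ r.toReal :=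
      fun N => lp.sum_rpow_le_norm_rpow hrpos lam N
    refine ⟨Real.sqrt (8 / 3 + 2 * 2 ^ r.toReal * ‖lam‖ ^ r.toReal), Real.sqrt_nonneg _, ?_⟩
    refine hy_hom p hp1 _ _ fun f hf N => ?_
    rw [Real.sq_sqrt (by positivity)]
    exact hy_main p hp1 hp2 _ hrr _ hlam _ hL f hf N
  · refine ⟨1, zero_le_one, hy_hom 2 hp1 _ _ fun f hf N => ?_⟩
    have hb := bessel f (MemLp.of_bound f.continuous.aestronglyMeasurable ‖f‖
      (Filter.Eventually.of_forall f.norm_coe_le_norm)) N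
    simp only [Real.rpow_ofNat] at hf
    refine le_trans (Finset.sum_le_sum fun n _ => ?_) (hb.trans (by simpa using hf))
    rw [norm_mul]
    gcongr
    exact mul_le_of_le_one_left (norm_nonneg _) (hlam n)

/-- let `1 < p ≤ 2` and `2 ≤ r ≤ ∞` with `1/p = 1/r + 1/2`, let
`(λ_n) ∈ ℓ_r(ℤ)` with `|λ_n| ≤ 1`, and let `T_λ : C([0,1], ℓ₂(ℤ)) → ℓ₂(ℤ)` be the bounded
operator `T_λ φ = (λ_n ⟨φ̂(n), e_n⟩)_n`, where `φ̂(n) = ∫₀¹ φ(t) e^{2πint} dt`.  Then the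
induced operator `T_λ#` (determined by `(T_λ# f) y = T_λ (f ⊗ y)`) maps `C[0,1]` into
`Π_p(ℓ₂(ℤ), ℓ₂(ℤ))`, and `T_λ# : C[0,1] → Π_p(ℓ₂(ℤ), ℓ₂(ℤ))` is p-summing. -/
theorem statement14 (p : ℝ) (r : ℝ≥0∞) [Fact (1 ≤ r)] (hp1 : 1 < p) (hp2 : p ≤ 2)
    (hr : 2 ≤ r) (hpr : 1 / ENNReal.ofReal p = 1 / r + 1 / 2)
    (lam : ↥(lp (fun _ : ℤ => ℂ) r)) (hlam : ∀ n : ℤ, ‖lam n‖ ≤ 1)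
    (T : C(Set.Icc (0 : ℝ) 1, ↥(lp (fun _ : ℤ => ℂ) 2)) →L[ℂ] ↥(lp (fun _ : ℤ => ℂ) 2))
    (hT : ∀ φ (n : ℤ), (T φ : ∀ _ : ℤ, ℂ) n = lam n * fourierCoeffCM φ n n) :
    ∃ S : C(Set.Icc (0 : ℝ) 1, ℂ) →
        (↥(lp (fun _ : ℤ => ℂ) 2) →L[ℂ] ↥(lp (fun _ : ℤ => ℂ) 2)),
      (∀ f y, S f y = T (cmSmul f y)) ∧
      (∀ f, IsPSumming p (S f)) ∧
      ∃ C, 0 ≤ C ∧ ∀ (n : ℕ) (v : Fin n → C(Set.Icc (0 : ℝ) 1, ℂ)),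
        (∑ i, pNorm p (S (v i)) ^ p) ^ (1 / p) ≤ C * weakNorm p v := by
  obtain ⟨M, hM, hbd⟩ := hy_final p r hp1 hp2 hpr lam hlam
  have hp0 : 0 < p := by linarith
  have hsum : ∀ f : C(I01, ℂ), SummingWithC p p
      (12 ^ (1 / p) * (M * (∫ t, ‖f t‖ ^ p) ^ (1 / p))) (T.comp (tens f)) := by
    intro f
    refine diag_summing p hp1 hp2 _ (fun n => lam n * ∫ t, EE n t * f t) (fun y n => ?_) _
      (by positivity) (hbd f)
    change (T (cmSmul f y) : ℤ → ℂ) n = _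
    rw [hT, four_tens, mul_assoc]
  refine ⟨fun f => T.comp (tens f), fun f y => rfl, fun f => ⟨_, by positivity, hsum f⟩,
    12 ^ (1 / p) * M, by positivity, fun n v => ?_⟩
  have hint : ∀ f : C(I01, ℂ), Integrable (fun t => ‖f t‖ ^ p) (volume : Measure I01) := fun f =>
    ((by fun_prop : Continuous fun t => ‖f t‖).rpow_const
      (fun _ => Or.inr (by linarith))).integrable_of_hasCompactSupport
        (HasCompactSupport.of_compactSpace _)
  have h0 : ∀ f : C(I01, ℂ), 0 ≤ ∫ t, ‖f t‖ ^ p := fun f => integral_nonneg fun t => by positivity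
  have hpn0 : ∀ f : C(I01, ℂ), 0 ≤ pNorm p (T.comp (tens f)) := fun f =>
    Real.sInf_nonneg fun C hC => hC.1
  have hpn : ∀ f : C(I01, ℂ), pNorm p (T.comp (tens f)) ≤
      12 ^ (1 / p) * (M * (∫ t, ‖f t‖ ^ p) ^ (1 / p)) := fun f =>
    csInf_le ⟨0, fun C hC => hC.1⟩ ⟨by positivity, hsum f⟩
  have hw := weak_nonneg p v
  have hint2 : ∑ i, ∫ t, ‖v i t‖ ^ p ≤ weakNorm p v ^ p := by
    rw [← integral_finset_sum _ fun i _ => hint (v i)]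
    calc ∫ t, ∑ i, ‖v i t‖ ^ p ≤ ∫ t : I01, weakNorm p v ^ p := by
          refine integral_mono (integrable_finset_sum _ fun i _ => hint (v i))
            (integrable_const _) fun t => ?_
          refine weak_le_one p hp1 v (ContinuousMap.evalCLM ℂ t) ?_
          refine ContinuousLinearMap.opNorm_le_bound _ zero_le_one fun f => ?_
          rw [one_mul]
          exact f.norm_coe_le_norm t
      _ = weakNorm p v ^ p := by
          rw [integral_const]
          have := isProb
          simp
  have hfin : ∑ i, pNorm p (T.comp (tens (v i))) ^ p ≤ (12 ^ (1 / p) * M * weakNorm p v) ^ p := by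
    rw [Real.mul_rpow (by positivity) hw]
    calc ∑ i, pNorm p (T.comp (tens (v i))) ^ p
        ≤ ∑ i, (12 ^ (1 / p) * M) ^ p * ∫ t, ‖v i t‖ ^ p := by
          refine Finset.sum_le_sum fun i _ => ?_
          refine (Real.rpow_le_rpow (hpn0 _) (hpn (v i)) hp0.le).trans (le_of_eq ?_)
          rw [← mul_assoc, Real.mul_rpow (by positivity) (Real.rpow_nonneg (h0 _) _),
            ← Real.rpow_mul (h0 _), one_div_mul_cancel hp0.ne', Real.rpow_one]
      _ = (12 ^ (1 / p) * M) ^ p * ∑ i, ∫ t, ‖v i t‖ ^ p := by rw [Finset.mul_sum]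
      _ ≤ _ := by gcongr
  have h5 := Real.rpow_le_rpow (Finset.sum_nonneg fun i _ => Real.rpow_nonneg (hpn0 _) _) hfin
    (by positivity : 0 ≤ 1 / p)
  rwa [← Real.rpow_mul (by positivity), mul_one_div_cancel hp0.ne', Real.rpow_one] at h5
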